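/- Every simple left D-module of ℂ-dimension 2 is isomorphic, as a D-module, to V_{i,j} for some (i,j) ∈ Λ_p. -/

import Mathlib

open scoped TensorProduct

noncomputable section

/-- Generator `a` of the free algebra on four generators. -/
def fa : FreeAlgebra ℂ (Fin 4) := FreeAlgebra.ι ℂ (0 : Fin 4)

/-- Generator `b` of the free algebra on four generators. -/
def fb : FreeAlgebra ℂ (Fin 4) := FreeAlgebra.ι ℂ (1 : Fin 4)

/-- Generator `g` of the free algebra on four generators. -/
def fg : FreeAlgebra ℂ (Fin 4) := FreeAlgebra.ι ℂ (2 : Fin 4)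

/-- Generator `x` of the free algebra on four generators. -/
def fx : FreeAlgebra ℂ (Fin 4) := FreeAlgebra.ι ℂ (3 : Fin 4)

/-- The defining relations of the Drinfeld double `D = D(H_{p,-1}^cop)`. -/
inductive DRel (p : ℕ) (ξ θ : ℂ) : FreeAlgebra ℂ (Fin 4) → FreeAlgebra ℂ (Fin 4) → Prop
  | a_pow : DRel p ξ θ (fa ^ (2 * p)) 1
  | b_sq : DRel p ξ θ (fb * fb) 0
  | b_a : DRel p ξ θ (fb * fa) (ξ • (fa * fb))
  | g_pow : DRel p ξ θ (fg ^ (2 * p)) 1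
  | x_sq : DRel p ξ θ (fx * fx) (1 - fg * fg)
  | g_x : DRel p ξ θ (fg * fx) (-(fx * fg))
  | a_g : DRel p ξ θ (fa * fg) (fg * fa)
  | b_g : DRel p ξ θ (fb * fg) (-(fg * fb))
  | a_x : DRel p ξ θ (fa * fx - ξ • (fx * fa))
      ((((ξ - 1) / (ξ + 1))⁻¹ * θ * ξ ^ (p + 1)) • (fb * fa ^ p - fg * fb))
  | b_x : DRel p ξ θ (fb * fx - ξ • (fx * fb))
      ((θ * ξ ^ (p + 1)) • (fa ^ (p + 1) - fg * fa))

/-- The Drinfeld double `D = D(H_{p,-1}^cop)`, presented by generators and relations. -/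
abbrev DAlg (p : ℕ) (ξ θ : ℂ) : Type := RingQuot (DRel p ξ θ)

/-- The image of the generator `a` in `D`. -/
def aD (p : ℕ) (ξ θ : ℂ) : DAlg p ξ θ := RingQuot.mkAlgHom ℂ (DRel p ξ θ) fa

/-- The image of the generator `b` in `D`. -/
def bD (p : ℕ) (ξ θ : ℂ) : DAlg p ξ θ := RingQuot.mkAlgHom ℂ (DRel p ξ θ) fb

/-- The image of the generator `g` in `D`. -/
def gD (p : ℕ) (ξ θ : ℂ) : DAlg p ξ θ := RingQuot.mkAlgHom ℂ (DRel p ξ θ) fg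

/-- The image of the generator `x` in `D`. -/
def xD (p : ℕ) (ξ θ : ℂ) : DAlg p ξ θ := RingQuot.mkAlgHom ℂ (DRel p ξ θ) fx

/-- The matrix of the action of `a` on `V_{i,j}`. -/
def Ma (ξ : ℂ) (i : ℕ) : Matrix (Fin 2) (Fin 2) ℂ := !![ξ ^ i, 0; 0, ξ ^ (i + 1)]

/-- The matrix of the action of `b` on `V_{i,j}`. -/
def Mb : Matrix (Fin 2) (Fin 2) ℂ := !![0, 1; 0, 0]

/-- The matrix of the action of `g` on `V_{i,j}`. -/
def Mg (ξ : ℂ) (j : ℕ) : Matrix (Fin 2) (Fin 2) ℂ := !![ξ ^ j, 0; 0, -ξ ^ j]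

/-- The matrix of the action of `x` on `V_{i,j}`. -/
def Mx (p : ℕ) (ξ θ : ℂ) (i j : ℕ) : Matrix (Fin 2) (Fin 2) ℂ :=
  !![0, θ⁻¹ * ξ ^ ((p : ℤ) - 1 - (i : ℤ)) * ((-1 : ℂ) ^ i + ξ ^ j);
     θ * ξ ^ (p + 1 + i) * ((-1 : ℂ) ^ i - ξ ^ j), 0]

/-- A subspace stable under the four generators is stable under the whole algebra. -/
theorem DAlg.stable_of_generators {p : ℕ} {ξ θ : ℂ} {V : Type} [AddCommGroup V] [Module ℂ V]
    (ρ : DAlg p ξ θ →ₐ[ℂ] Module.End ℂ V) (W : Submodule ℂ V)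
    (ha : ∀ w ∈ W, ρ (aD p ξ θ) w ∈ W) (hb : ∀ w ∈ W, ρ (bD p ξ θ) w ∈ W)
    (hg : ∀ w ∈ W, ρ (gD p ξ θ) w ∈ W) (hx : ∀ w ∈ W, ρ (xD p ξ θ) w ∈ W)
    (d : DAlg p ξ θ) : ∀ w ∈ W, ρ d w ∈ W := by
  obtain ⟨f, rfl⟩ := RingQuot.mkAlgHom_surjective ℂ (DRel p ξ θ) d
  induction f using FreeAlgebra.induction with
  | grade0 r =>
    intro w hw
    rw [AlgHom.commutes, AlgHom.commutes, Module.algebraMap_end_apply]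
    exact W.smul_mem r hw
  | grade1 i =>
    fin_cases i
    exacts [ha, hb, hg, hx]
  | mul f₁ f₂ h₁ h₂ =>
    intro w hw
    rw [map_mul, map_mul]
    exact h₁ _ (h₂ _ hw)
  | add f₁ f₂ h₁ h₂ =>
    intro w hw
    rw [map_add, map_add]
    exact W.add_mem (h₁ _ hw) (h₂ _ hw)

/-- The defining relations of `DAlg p ξ θ`, for a quadruple of elements of a `ℂ`-algebra. -/
structure DoubleRelations {R : Type*} [Ring R] [Algebra ℂ R] (p : ℕ) (ξ θ : ℂ)
    (A B G X : R) : Prop where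
  a_pow : A ^ (2 * p) = 1
  b_sq : B * B = 0
  b_a : B * A = ξ • (A * B)
  g_pow : G ^ (2 * p) = 1
  x_sq : X * X = 1 - G * G
  g_x : G * X = -(X * G)
  a_g : A * G = G * A
  b_g : B * G = -(G * B)
  a_x : A * X - ξ • (X * A) =
    (((ξ - 1) / (ξ + 1))⁻¹ * θ * ξ ^ (p + 1)) • (B * A ^ p - G * B)
  b_x : B * X - ξ • (X * B) = (θ * ξ ^ (p + 1)) • (A ^ (p + 1) - G * A)

/-- The images of the generators under an algebra homomorphism satisfy the relations. -/
theorem DAlg.relations {R : Type*} [Ring R] [Algebra ℂ R] {p : ℕ} {ξ θ : ℂ}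
    (ρ : DAlg p ξ θ →ₐ[ℂ] R) :
    DoubleRelations p ξ θ (ρ (aD p ξ θ)) (ρ (bD p ξ θ)) (ρ (gD p ξ θ)) (ρ (xD p ξ θ)) := by
  have key : ∀ {f f' : FreeAlgebra ℂ (Fin 4)}, DRel p ξ θ f f' →
      ρ (RingQuot.mkAlgHom ℂ (DRel p ξ θ) f) = ρ (RingQuot.mkAlgHom ℂ (DRel p ξ θ) f') :=
    fun h => congrArg ρ (RingQuot.mkAlgHom_rel ℂ h)
  unfold aD bD gD xD
  constructor
  · simpa only [map_pow, map_one] using key .a_pow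
  · simpa only [map_mul, map_zero] using key .b_sq
  · simpa only [map_mul, map_smul] using key .b_a
  · simpa only [map_pow, map_one] using key .g_pow
  · simpa only [map_mul, map_sub, map_one] using key .x_sq
  · simpa only [map_mul, map_neg] using key .g_x
  · simpa only [map_mul] using key .a_g
  · simpa only [map_mul, map_neg] using key .b_g
  · simpa only [map_sub, map_mul, map_smul, map_pow] using key .a_x
  · simpa only [map_sub, map_mul, map_smul, map_pow] using key .b_x

section LinearAlgebra

variable {V : Type*} [AddCommGroup V] [Module ℂ V]

/-- A square-zero operator whose kernel is either zero or the whole space vanishes. -/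
theorem Module.End.eq_zero_of_sq_eq_zero_of_ker {T : Module.End ℂ V}
    (hT : T * T = 0) (hker : LinearMap.ker T = ⊥ ∨ LinearMap.ker T = ⊤) : T = 0 := by
  rcases hker with h | h
  · ext v
    have h₀ : T (T v) = 0 := LinearMap.congr_fun hT v
    rw [LinearMap.ker_eq_bot] at h
    exact h (by simpa using h₀)
  · exact LinearMap.ker_eq_top.mp h

/-- Two commuting operators on a complex vector space of finite dimension at least two have
a nontrivial common invariant subspace. -/
theorem Module.End.false_of_commute_of_irreducible {A G : Module.End ℂ V}
    (hdim : 1 < Module.finrank ℂ V) (hAG : A * G = G * A)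
    (hsimple : ∀ W : Submodule ℂ V, (∀ w ∈ W, A w ∈ W) → (∀ w ∈ W, G w ∈ W) →
      W = ⊥ ∨ W = ⊤) : False := by
  have : FiniteDimensional ℂ V := Module.finite_of_finrank_pos (by omega)
  have : Nontrivial V := Module.nontrivial_of_finrank_pos (R := ℂ) (by omega)
  have key : ∀ T : Module.End ℂ V, A * T = T * A → G * T = T * G →
      ∃ μ : ℂ, ∀ v, T v = μ • v := by
    intro T hA hG
    obtain ⟨μ, hμ⟩ := Module.End.exists_eigenvalue T
    refine ⟨μ, fun v => ?_⟩
    have hc : ∀ S : Module.End ℂ V, S * T = T * S →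
        ∀ w ∈ Module.End.eigenspace T μ, S w ∈ Module.End.eigenspace T μ := by
      intro S hS w hw
      rw [Module.End.mem_eigenspace_iff] at hw ⊢
      rw [← Module.End.mul_apply, ← hS, Module.End.mul_apply, hw, map_smul]
    rcases hsimple _ (hc A hA) (hc G hG) with h | h
    · exact absurd h hμ
    · exact Module.End.mem_eigenspace_iff.mp (h ▸ Submodule.mem_top)
  obtain ⟨α, hα⟩ := key A rfl hAG.symm
  obtain ⟨γ, hγ⟩ := key G hAG rfl
  obtain ⟨v, hv⟩ := exists_ne (0 : V)
  have hspan : ∀ (T : Module.End ℂ V) (μ : ℂ), (∀ v, T v = μ • v) →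
      ∀ w ∈ ℂ ∙ v, T w ∈ ℂ ∙ v := by
    intro T μ hT w hw
    rw [hT]
    exact Submodule.smul_mem _ _ hw
  rcases hsimple (ℂ ∙ v) (hspan A α hα) (hspan G γ hγ) with h | h
  · exact hv (Submodule.span_singleton_eq_bot.mp h)
  · have h₁ := finrank_span_singleton (K := ℂ) hv
    rw [h, finrank_top] at h₁
    omega

/-- If `B w = v`, `B v = 0` and `v ≠ 0`, then `v`, `w` are linearly independent. -/
theorem Module.End.linearIndependent_of_chain {B : Module.End ℂ V} {v w : V}
    (hv : v ≠ 0) (hBv : B v = 0) (hBw : B w = v) : LinearIndependent ℂ ![v, w] := by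
  rw [LinearIndependent.pair_iff]
  intro s t h
  have ht : t = 0 := by
    have h₁ := congrArg B h
    simpa [hBv, hBw, hv] using h₁
  subst ht
  simpa [hv] using h

end LinearAlgebra

theorem IsPrimitiveRoot.pow_half_eq_neg_one {p : ℕ} (hp : 1 ≤ p) {ξ : ℂ}
    (hξ : IsPrimitiveRoot ξ (2 * p)) : ξ ^ p = -1 := by
  have h₁ : ξ ^ p ≠ 1 := hξ.pow_ne_one_of_pos_of_lt (by omega) (by omega)
  have h₂ : ξ ^ p * ξ ^ p = 1 := by rw [← pow_add, ← two_mul, hξ.pow_eq_one]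
  exact (mul_self_eq_one_iff.mp h₂).resolve_left h₁

/-- A nonzero nilpotent `b` on a two-dimensional space yields a basis in which `a` and `g` are
diagonal and `b` is a Jordan block. -/
theorem exists_basis_of_b_ne_zero {ξ : ℂ} (hξ₁ : ξ ≠ 1)
    {V : Type*} [AddCommGroup V] [Module ℂ V] (hdim : Module.finrank ℂ V = 2)
    {A B G : Module.End ℂ V} {n : ℕ} (hn : n ≠ 0) (hA : A ^ n = 1) (hG : G ^ n = 1)
    (hBB : B * B = 0) (hBA : B * A = ξ • (A * B)) (hAG : A * G = G * A)
    (hBG : B * G = -(G * B)) (hB : B ≠ 0) :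
    ∃ (e : Module.Basis (Fin 2) ℂ V) (α γ : ℂ), α ^ n = 1 ∧ γ ^ n = 1 ∧
      A (e 0) = α • e 0 ∧ A (e 1) = (ξ * α) • e 1 ∧ B (e 0) = 0 ∧ B (e 1) = e 0 ∧
      G (e 0) = γ • e 0 ∧ G (e 1) = -γ • e 1 := by
  obtain ⟨w, hw⟩ : ∃ w, B w ≠ 0 := by
    by_contra! h
    exact hB (LinearMap.ext h)
  have hBB' : ∀ u, B (B u) = 0 := fun u => LinearMap.congr_fun hBB u
  have hBA' : ∀ u, B (A u) = ξ • A (B u) := fun u => LinearMap.congr_fun hBA u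
  have hAG' : ∀ u, A (G u) = G (A u) := fun u => LinearMap.congr_fun hAG u
  have hBG' : ∀ u, B (G u) = -G (B u) := fun u => LinearMap.congr_fun hBG u
  set v := B w with hv
  have hBv : B v = 0 := hBB' w
  have decomp : ∀ w', B w' = v → ∃ e : Module.Basis (Fin 2) ℂ V, e 0 = v ∧ e 1 = w' := by
    intro w' hw'
    refine ⟨basisOfLinearIndependentOfCardEqFinrank
      (Module.End.linearIndependent_of_chain hw hBv hw') (by simp [hdim]), ?_, ?_⟩ <;> simp
  have coords : ∀ w', B w' = v → ∀ u, ∃ r s : ℂ, u = r • v + s • w' ∧ B u = s • v := by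
    intro w' hw' u
    obtain ⟨e, h₀, h₁⟩ := decomp w' hw'
    have hu : u = e.repr u 0 • v + e.repr u 1 • w' := by
      have := e.sum_repr u
      rw [Fin.sum_univ_two, h₀, h₁] at this
      exact this.symm
    refine ⟨_, _, hu, ?_⟩
    conv_lhs => rw [hu]
    simp [hBv, hw']
  have eigen : ∀ T : Module.End ℂ V, B (T v) = 0 → ∃ μ : ℂ, T v = μ • v := by
    intro T hT
    obtain ⟨r, s, h, h'⟩ := coords w rfl (T v)
    have hs : s = 0 := by simpa [hT, hw] using h'.symm
    exact ⟨r, by simpa [hs] using h⟩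
  have eigen_pow : ∀ (T : Module.End ℂ V) (μ : ℂ), T ^ n = 1 → T v = μ • v → μ ^ n = 1 := by
    intro T μ hT hμ
    have h : (T ^ n) v = μ ^ n • v :=
      (Module.End.HasEigenvector.pow_apply ⟨Module.End.mem_eigenspace_iff.mpr hμ, hw⟩ n)
    rw [hT, Module.End.one_apply] at h
    exact smul_left_injective ℂ hw (by simpa using h.symm)
  obtain ⟨α, hα⟩ := eigen A (by simp [hBA', hBv])
  obtain ⟨γ, hγ⟩ := eigen G (by simp [hBG', hBv])
  have hαn := eigen_pow A α hA hα
  have hγn := eigen_pow G γ hG hγ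
  have hα₀ : α ≠ 0 := by
    rintro rfl
    simp [hn] at hαn
  have hξ' : ξ - 1 ≠ 0 := sub_ne_zero.mpr hξ₁
  obtain ⟨c, s, hAw, hs⟩ := coords w rfl (A w)
  have hs' : s = ξ * α := by
    rw [hBA', ← hv, hα, smul_smul] at hs
    exact (smul_left_injective ℂ hw hs).symm
  subst hs'
  have hBu : B (w + (c / (α * (ξ - 1))) • v) = v := by simp [hBv, ← hv]
  set u := w + (c / (α * (ξ - 1))) • v with hu
  have hAu : A u = (ξ * α) • u := by
    rw [hu, map_add, map_smul, hAw, hα]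
    match_scalars
    · field_simp
      ring
    · ring
  obtain ⟨d, t, hGu, ht⟩ := coords u hBu (G u)
  have ht' : t = -γ := by
    rw [hBG', hBu, hγ, ← neg_smul] at ht
    exact (smul_left_injective ℂ hw ht).symm
  subst ht'
  have hd : d = 0 := by
    have h := hAG' u
    rw [hAu, map_smul, hGu, map_add, map_smul, map_smul, hα, hAu] at h
    have h' : (d * α * (ξ - 1)) • v = 0 := by
      rw [← sub_eq_zero] at h
      rw [← neg_eq_zero, ← h]
      module
    simpa [hw, hα₀, hξ'] using h'
  obtain ⟨e, h₀, h₁⟩ := decomp u hBu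
  refine ⟨e, α, γ, hαn, hγn, ?_⟩
  rw [h₀, h₁]
  exact ⟨hα, hAu, hBv, hBu, hγ, by simpa [hd] using hGu⟩

theorem ker_stable_of_mul_eq_smul {V : Type*} [AddCommGroup V] [Module ℂ V]
    {S T : Module.End ℂ V} {c : ℂ} (h : T * S = c • (S * T)) :
    ∀ w ∈ LinearMap.ker T, S w ∈ LinearMap.ker T := by
  intro w hw
  rw [LinearMap.mem_ker] at hw ⊢
  have h' := LinearMap.congr_fun h w
  simpa [hw] using h'

theorem eq_one_of_theta_eq_zero {p : ℕ} (hp : 1 ≤ p) {ξ θ : ℂ}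
    (hξ : IsPrimitiveRoot ξ (2 * p))
    (hθ : θ ^ 2 = (1 - (ξ ^ 2)⁻¹) * ((ξ - 1) / (ξ + 1))) (h : θ = 0) : p = 1 := by
  have hξ2 : ξ ^ 2 = 1 := by
    rw [h] at hθ
    have h' := hθ.symm
    rw [zero_pow two_ne_zero, mul_eq_zero, div_eq_zero_iff] at h'
    rcases h' with h' | h' | h'
    · exact inv_eq_one.mp (sub_eq_zero.mp h').symm
    · linear_combination (ξ + 1) * h'
    · linear_combination (ξ - 1) * h'
  have := Nat.le_of_dvd two_pos (hξ.dvd_of_pow_eq_one 2 hξ2)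
  omega

namespace DoubleRelations

variable {p : ℕ} {ξ θ : ℂ} {V : Type*} [AddCommGroup V] [Module ℂ V]
  {A B G X : Module.End ℂ V}

/-- On an irreducible module of dimension at least two, the generator `b` acts nontrivially. -/
theorem b_ne_zero (h : DoubleRelations p ξ θ A B G X) (hp : 1 ≤ p) (hξ₀ : ξ ≠ 0)
    (hθp : θ = 0 → p = 1) (hdim : 1 < Module.finrank ℂ V)
    (hsimple : ∀ W : Submodule ℂ V, (∀ w ∈ W, A w ∈ W) → (∀ w ∈ W, B w ∈ W) →
      (∀ w ∈ W, G w ∈ W) → (∀ w ∈ W, X w ∈ W) → W = ⊥ ∨ W = ⊤) : B ≠ 0 := by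
  rintro rfl
  have hGG : G * G = 1 := by
    by_cases hθ : θ = 0
    · have hg := h.g_pow
      rwa [hθp hθ, mul_one, pow_two] at hg
    · have h₁ : A ^ p * A = G * A := by
        have h₂ := h.b_x
        rw [zero_mul, mul_zero, smul_zero, sub_zero, eq_comm, smul_eq_zero] at h₂
        rw [← pow_succ]
        exact sub_eq_zero.mp (h₂.resolve_left (mul_ne_zero hθ (pow_ne_zero _ hξ₀)))
      have h₃ : A * A ^ (2 * p - 1) = 1 := by
        rw [← pow_succ', Nat.sub_add_cancel (by omega), h.a_pow]
      have h₄ : A ^ p = G := by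
        simpa [mul_assoc, h₃] using congrArg (· * A ^ (2 * p - 1)) h₁
      rw [← h₄, ← pow_add, ← two_mul, h.a_pow]
  have hXX : X * X = 0 := by rw [h.x_sq, hGG, sub_self]
  have hXA : X * A = ξ⁻¹ • (A * X) := by
    have h₁ := h.a_x
    rw [zero_mul, mul_zero, sub_zero, smul_zero, sub_eq_zero] at h₁
    rw [h₁, inv_smul_smul₀ hξ₀]
  have hX : X = 0 := Module.End.eq_zero_of_sq_eq_zero_of_ker hXX <| hsimple _
    (ker_stable_of_mul_eq_smul hXA) (by simp)
    (ker_stable_of_mul_eq_smul (c := -1) (by rw [neg_one_smul, h.g_x, neg_neg]))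
    (ker_stable_of_mul_eq_smul (c := 1) (by rw [one_smul]))
  refine Module.End.false_of_commute_of_irreducible hdim h.a_g fun W hA hG => ?_
  exact hsimple W hA (by simp) hG (by simp [hX])

/-- Irreducible modules with nonzero `b`-action exist only for `θ ≠ 0`. -/
theorem theta_ne_zero (h : DoubleRelations p ξ θ A B G X) (hB : B ≠ 0)
    (hsimple : ∀ W : Submodule ℂ V, (∀ w ∈ W, A w ∈ W) → (∀ w ∈ W, B w ∈ W) →
      (∀ w ∈ W, G w ∈ W) → (∀ w ∈ W, X w ∈ W) → W = ⊥ ∨ W = ⊤) : θ ≠ 0 := by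
  rintro rfl
  refine hB (Module.End.eq_zero_of_sq_eq_zero_of_ker h.b_sq <| hsimple _
    (ker_stable_of_mul_eq_smul h.b_a) (ker_stable_of_mul_eq_smul (c := 1) (by rw [one_smul]))
    (ker_stable_of_mul_eq_smul (c := -1) (by rw [neg_one_smul, h.b_g]))
    (ker_stable_of_mul_eq_smul (c := ξ) ?_))
  have h₁ := h.b_x
  rwa [zero_mul, zero_smul, sub_eq_zero] at h₁

/-- The action of `x` in a basis diagonalising `a` and `g` is determined by the relations. -/
theorem x_action (h : DoubleRelations p ξ θ A B G X) (hξp : ξ ^ p = -1) (hξ₁ : ξ ≠ 1)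
    (hξ₂ : ξ ≠ -1) (hθ₀ : θ ≠ 0)
    (hθ : θ ^ 2 = (1 - (ξ ^ 2)⁻¹) * ((ξ - 1) / (ξ + 1)))
    {e : Module.Basis (Fin 2) ℂ V} {α γ : ℂ} (hα₀ : α ≠ 0) (hγ₀ : γ ≠ 0)
    (hA₀ : A (e 0) = α • e 0) (hA₁ : A (e 1) = (ξ * α) • e 1)
    (hB₀ : B (e 0) = 0) (hB₁ : B (e 1) = e 0)
    (hG₀ : G (e 0) = γ • e 0) (hG₁ : G (e 1) = -γ • e 1) :
    X (e 0) = (θ * ξ ^ (p + 1) * α * (α ^ p - γ)) • e 1 ∧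
      X (e 1) = (θ⁻¹ * ξ ^ ((p : ℤ) - 1) * α⁻¹ * (α ^ p + γ)) • e 0 := by
  have hξ₀ : ξ ≠ 0 := by
    rintro rfl
    simp [zero_pow_eq] at hξp
    split_ifs at hξp <;> norm_num at hξp
  have expand : ∀ u, u = e.repr u 0 • e 0 + e.repr u 1 • e 1 := by
    intro u
    conv_lhs => rw [← e.sum_repr u, Fin.sum_univ_two]
  have coord : ∀ a b c d : ℂ, a • e 0 + b • e 1 = c • e 0 + d • e 1 → a = c ∧ b = d := by
    intro a b c d hab
    have h₀ := congrArg (fun u => e.repr u 0) hab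
    have h₁ := congrArg (fun u => e.repr u 1) hab
    simp at h₀ h₁
    exact ⟨h₀, h₁⟩
  have hApow₀ : ∀ n, (A ^ n) (e 0) = α ^ n • e 0 := fun n =>
    Module.End.HasEigenvector.pow_apply ⟨Module.End.mem_eigenspace_iff.mpr hA₀, e.ne_zero 0⟩ n
  have hApow₁ : ∀ n, (A ^ n) (e 1) = (ξ * α) ^ n • e 1 := fun n =>
    Module.End.HasEigenvector.pow_apply ⟨Module.End.mem_eigenspace_iff.mpr hA₁, e.ne_zero 1⟩ n
  have hGX : ∀ u, G (X u) = -X (G u) := fun u => LinearMap.congr_fun h.g_x u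
  obtain ⟨s, hs⟩ : ∃ s : ℂ, X (e 0) = s • e 1 := by
    have h₁ := hGX (e 0)
    have h₂ := expand (X (e 0))
    generalize e.repr (X (e 0)) 0 = r at h₂
    generalize e.repr (X (e 0)) 1 = s at h₂
    rw [hG₀, map_smul, h₂, map_add, map_smul, map_smul, hG₀, hG₁] at h₁
    have h₃ := (coord (r * γ) (-s * γ) (-γ * r) (-γ * s)
      (by linear_combination (norm := module) h₁)).1
    have hr : r = 0 := by
      have : 2 * γ * r = 0 := by linear_combination h₃
      simpa [hγ₀] using this
    exact ⟨s, by simpa [hr] using h₂⟩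
  obtain ⟨t, ht⟩ : ∃ t : ℂ, X (e 1) = t • e 0 := by
    have h₁ := hGX (e 1)
    have h₂ := expand (X (e 1))
    generalize e.repr (X (e 1)) 0 = t at h₂
    generalize e.repr (X (e 1)) 1 = r at h₂
    rw [hG₁, map_smul, h₂, map_add, map_smul, map_smul, hG₀, hG₁] at h₁
    have h₃ := (coord (t * γ) (-r * γ) (γ * t) (γ * r)
      (by linear_combination (norm := module) h₁)).2
    have hr : r = 0 := by
      have : 2 * γ * r = 0 := by linear_combination -h₃
      simpa [hγ₀] using this
    exact ⟨t, by simpa [hr] using h₂⟩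
  constructor
  · have h₁ := LinearMap.congr_fun h.b_x (e 0)
    simp only [LinearMap.sub_apply, Module.End.mul_apply, LinearMap.smul_apply, hs, hB₀, hB₁,
      map_smul, map_zero, smul_zero, sub_zero, hApow₀, hA₀, hG₀] at h₁
    have h₂ := smul_left_injective ℂ (e.ne_zero 0) (a₁ := s)
      (a₂ := θ * ξ ^ (p + 1) * α * (α ^ p - γ)) (by
        change s • e 0 = _ • e 0
        rw [h₁]
        module)
    rw [hs, h₂]
  · have h₁ := LinearMap.congr_fun h.a_x (e 1)
    simp only [LinearMap.sub_apply, Module.End.mul_apply, LinearMap.smul_apply, ht, hB₁, map_smul,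
      hApow₁, hA₀, hA₁, hG₀] at h₁
    have h₂ := smul_left_injective ℂ (e.ne_zero 0) (a₁ := t * α * (1 - ξ ^ 2))
      (a₂ := ((ξ - 1) / (ξ + 1))⁻¹ * θ * ξ ^ (p + 1) * ((ξ * α) ^ p - γ)) (by
        change _ • e 0 = _ • e 0
        linear_combination (norm := module) h₁)
    have hm : ξ - 1 ≠ 0 := sub_ne_zero.mpr hξ₁
    have hq : ξ + 1 ≠ 0 := fun h => hξ₂ (eq_neg_of_add_eq_zero_left h)
    rw [mul_pow, pow_succ ξ p, hξp] at h₂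
    rw [ht, zpow_sub₀ hξ₀, zpow_natCast, zpow_one, hξp]
    congr 1
    have hθ' : θ ^ 2 * ξ ^ 2 = (ξ - 1) ^ 2 := by
      rw [hθ]
      field_simp
      ring
    have h₃ : t * α * (ξ - 1) ^ 2 = -θ * ξ * (α ^ p + γ) := by
      rw [inv_div] at h₂
      field_simp at h₂
      have : (ξ + 1) * (t * α * (ξ - 1) ^ 2 - -θ * ξ * (α ^ p + γ)) = 0 := by
        linear_combination -h₂
      exact sub_eq_zero.mp ((mul_eq_zero.mp this).resolve_left hq)
    field_simp
    rw [← hθ'] at h₃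
    have : θ * ξ * (t * θ * ξ * α + (α ^ p + γ)) = 0 := by linear_combination h₃
    have h₄ := (mul_eq_zero.mp this).resolve_left (mul_ne_zero hθ₀ hξ₀)
    linear_combination h₄

/-- Normal form of an irreducible two-dimensional module. -/
theorem exists_normal_form (h : DoubleRelations p ξ θ A B G X) (hp : 1 ≤ p)
    (hξ : IsPrimitiveRoot ξ (2 * p))
    (hθ : θ ^ 2 = (1 - (ξ ^ 2)⁻¹) * ((ξ - 1) / (ξ + 1))) (hdim : Module.finrank ℂ V = 2)
    (hsimple : ∀ W : Submodule ℂ V, (∀ w ∈ W, A w ∈ W) → (∀ w ∈ W, B w ∈ W) →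
      (∀ w ∈ W, G w ∈ W) → (∀ w ∈ W, X w ∈ W) → W = ⊥ ∨ W = ⊤) :
    ∃ i j : ℕ, i < 2 * p ∧ j < 2 * p ∧ ξ ^ (p * i) ≠ ξ ^ j ∧
      ∃ e : Module.Basis (Fin 2) ℂ V,
        LinearMap.toMatrixAlgEquiv e A = Ma ξ i ∧ LinearMap.toMatrixAlgEquiv e B = Mb ∧
        LinearMap.toMatrixAlgEquiv e G = Mg ξ j ∧
        LinearMap.toMatrixAlgEquiv e X = Mx p ξ θ i j := by
  have hp' : 2 * p ≠ 0 := by omega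
  have : NeZero (2 * p) := ⟨hp'⟩
  have hξ₀ : ξ ≠ 0 := hξ.ne_zero hp'
  have hξ₁ : ξ ≠ 1 := hξ.ne_one (by omega)
  have hξp := hξ.pow_half_eq_neg_one hp
  have hB := h.b_ne_zero hp hξ₀ (eq_one_of_theta_eq_zero hp hξ hθ) (by omega) hsimple
  have hθ₀ := h.theta_ne_zero hB hsimple
  have hξ₂ : ξ ≠ -1 := by
    rintro rfl
    exact hθ₀ (pow_eq_zero_iff two_ne_zero |>.mp (by simpa using hθ))
  obtain ⟨e, α, γ, hα, hγ, hA₀, hA₁, hB₀, hB₁, hG₀, hG₁⟩ := exists_basis_of_b_ne_zero hξ₁ hdim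
    hp' h.a_pow h.g_pow h.b_sq h.b_a h.a_g h.b_g hB
  obtain ⟨i, hi, rfl⟩ := hξ.eq_pow_of_pow_eq_one hα
  obtain ⟨j, hj, rfl⟩ := hξ.eq_pow_of_pow_eq_one hγ
  obtain ⟨hX₀, hX₁⟩ := h.x_action hξp hξ₁ hξ₂ hθ₀ hθ (pow_ne_zero i hξ₀) (pow_ne_zero j hξ₀)
    hA₀ hA₁ hB₀ hB₁ hG₀ hG₁
  refine ⟨i, j, hi, hj, fun hij => ?_, e, ?_⟩
  · have hX₀' : X (e 0) = 0 := by
      rw [hX₀, ← pow_mul, mul_comm i p, hij, sub_self, mul_zero, zero_smul]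
    have stable : ∀ (T : Module.End ℂ V) (μ : ℂ), T (e 0) = μ • e 0 →
        ∀ w ∈ ℂ ∙ e 0, T w ∈ ℂ ∙ e 0 := by
      intro T μ hT w hw
      obtain ⟨r, rfl⟩ := Submodule.mem_span_singleton.mp hw
      rw [map_smul, hT]
      exact Submodule.smul_mem _ _ (Submodule.smul_mem _ _ (Submodule.mem_span_singleton_self _))
    rcases hsimple (ℂ ∙ e 0) (stable A _ hA₀) (stable B 0 (by rw [hB₀, zero_smul]))
      (stable G _ hG₀) (stable X 0 (by rw [hX₀', zero_smul])) with hW | hW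
    · exact e.ne_zero 0 (Submodule.span_singleton_eq_bot.mp hW)
    · have h₁ := finrank_span_singleton (K := ℂ) (e.ne_zero 0)
      rw [hW, finrank_top] at h₁
      omega
  · have hi' : ξ ^ (i * p) = (-1) ^ i := by rw [mul_comm, pow_mul, hξp]
    refine ⟨?_, ?_, ?_, ?_⟩ <;> ext k l <;> fin_cases k <;> fin_cases l <;>
      simp [LinearMap.toMatrixAlgEquiv_apply, Ma, Mb, Mg, Mx, hA₀, hA₁, hB₀, hB₁, hG₀, hG₁,
        hX₀, hX₁, pow_succ', ← pow_mul, hi', zpow_sub₀ hξ₀]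
    all_goals exact Or.inl (by ring)

end DoubleRelations

/-- every simple left `D`-module of `ℂ`-dimension 2 is isomorphic to `V_{i,j}`
for some `(i,j) ∈ Λ_p`. -/
theorem statement8 (p : ℕ) (hp : 1 ≤ p) (ξ θ : ℂ) (hξ : IsPrimitiveRoot ξ (2 * p))
    (hθ : θ ^ 2 = (1 - (ξ ^ 2)⁻¹) * ((ξ - 1) / (ξ + 1))) :
    ∀ (V : Type) [AddCommGroup V] [Module ℂ V],
      ∀ ρ : DAlg p ξ θ →ₐ[ℂ] Module.End ℂ V,
      Module.finrank ℂ V = 2 →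
      (∀ W : Submodule ℂ V, (∀ d : DAlg p ξ θ, ∀ w ∈ W, ρ d w ∈ W) → W = ⊥ ∨ W = ⊤) →
      ∃ i j : ℕ, i < 2 * p ∧ j < 2 * p ∧
        ¬ ((2 * p : ℤ) ∣ ((p : ℤ) * (i : ℤ) - (j : ℤ))) ∧
        ∃ σ : DAlg p ξ θ →ₐ[ℂ] Matrix (Fin 2) (Fin 2) ℂ,
          σ (aD p ξ θ) = Ma ξ i ∧ σ (bD p ξ θ) = Mb ∧
          σ (gD p ξ θ) = Mg ξ j ∧ σ (xD p ξ θ) = Mx p ξ θ i j ∧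
          ∃ e : V ≃ₗ[ℂ] (Fin 2 → ℂ),
            ∀ (d : DAlg p ξ θ) (v : V), e (ρ d v) = (σ d).mulVec (e v) := by
  intro V _ _ ρ hdim hsimple
  obtain ⟨i, j, hi, hj, hij, e, hA, hB, hG, hX⟩ :=
    (DAlg.relations ρ).exists_normal_form hp hξ hθ hdim fun W hA hB hG hX =>
      hsimple W (DAlg.stable_of_generators ρ W hA hB hG hX)
  refine ⟨i, j, hi, hj, fun hdvd => hij ?_,
    (LinearMap.toMatrixAlgEquiv e).toAlgHom.comp ρ, hA, hB, hG, hX, e.equivFun, fun d v => ?_⟩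
  · have h : ξ ^ ((p : ℤ) * i - j) = 1 :=
      (hξ.zpow_eq_one_iff_dvd _).mpr (by exact_mod_cast hdvd)
    have hξ₀ : ξ ≠ 0 := hξ.ne_zero (by omega)
    rw [zpow_sub₀ hξ₀, div_eq_one_iff_eq (zpow_ne_zero _ hξ₀)] at h
    exact_mod_cast h
  · exact (LinearMap.toMatrix_mulVec_repr e e (ρ d) v).symm
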